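/- Let H be a hypergraph, s a positive integer, and f, g hyperedges of H. There exists an s-walk between f and g if and only if there exists an s-path between f and g; moreover, when they exist, the minimum length of an s-walk between f and g equals the minimum length of an s-path between f and g. In particular, the s-distance d_s(f, g) defined via shortest s-walks coincides with the length of a shortest s-path. -/

import Mathlib

/-- A hypergraph is given by an indexed family `e : ι → Finset V` of hyperedges.
For a positive integer `s`, an `s`-walk of length `k` between the hyperedges (indexed by)
`f` and `g` is a sequence of hyperedge indices `w 0, w 1, …, w k` with `w 0 = f`, `w k = g`,
such that consecutive indices are distinct and consecutive hyperedges intersect in at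
least `s` vertices. -/
def IsSWalk {V ι : Type*} [DecidableEq V] (e : ι → Finset V) (s k : ℕ)
    (w : ℕ → ι) (f g : ι) : Prop :=
  w 0 = f ∧ w k = g ∧
    ∀ j, 1 ≤ j → j ≤ k → w (j - 1) ≠ w j ∧ s ≤ ((e (w (j - 1))) ∩ (e (w j))).card
/-- The `s`-distance between hyperedges: the length of a shortest `s`-walk,
or `∞` if no `s`-walk exists. -/
noncomputable def sDist {V ι : Type*} [DecidableEq V] (e : ι → Finset V) (s : ℕ)
    (f g : ι) : ℕ∞ :=
  sInf {n : ℕ∞ | ∃ k : ℕ, n = k ∧ ∃ w : ℕ → ι, IsSWalk e s k w f g}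

/-- An `s`-trace is an `s`-walk whose hyperedge indices are pairwise distinct. -/
def IsSTrace {V ι : Type*} [DecidableEq V] (e : ι → Finset V) (s k : ℕ)
    (w : ℕ → ι) (f g : ι) : Prop :=
  IsSWalk e s k w f g ∧ ∀ x ≤ k, ∀ y ≤ k, x ≠ y → w x ≠ w y

/-- An `s`-meander is an `s`-trace whose successive intersections
`I_j = e_{i_{j-1}} ∩ e_{i_j}` are pairwise distinct as sets. -/
def IsSMeander {V ι : Type*} [DecidableEq V] (e : ι → Finset V) (s k : ℕ)
    (w : ℕ → ι) (f g : ι) : Prop :=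
  IsSTrace e s k w f g ∧
    ∀ x, 1 ≤ x → x ≤ k → ∀ y, 1 ≤ y → y ≤ k → x ≠ y →
      e (w (x - 1)) ∩ e (w x) ≠ e (w (y - 1)) ∩ e (w y)

/-- An `s`-path is an `s`-meander in which no intersection is contained in another:
`I_x \\ I_y ≠ ∅` for all `x ≠ y`. -/
def IsSPath {V ι : Type*} [DecidableEq V] (e : ι → Finset V) (s k : ℕ)
    (w : ℕ → ι) (f g : ι) : Prop :=
  IsSMeander e s k w f g ∧
    ∀ x, 1 ≤ x → x ≤ k → ∀ y, 1 ≤ y → y ≤ k → x ≠ y →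
      ((e (w (x - 1)) ∩ e (w x)) \ (e (w (y - 1)) ∩ e (w y))).Nonempty

/-- Cutting `d` consecutive hyperedges out of an `s`-walk leaves an `s`-walk if the two sides
of the cut are distinct and `s`-adjacent. -/
theorem IsSWalk.exists_shortcut {V ι : Type*} [DecidableEq V] {e : ι → Finset V} {s k : ℕ}
    {w : ℕ → ι} {f g : ι} (h : IsSWalk e s k w f g) {a d : ℕ} (had : a + 1 + d ≤ k)
    (hne : w a ≠ w (a + 1 + d)) (hcard : s ≤ (e (w a) ∩ e (w (a + 1 + d))).card) :
    ∃ w', IsSWalk e s (k - d) w' f g := by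
  obtain ⟨h0, hk, hadj⟩ := h
  refine ⟨fun j => if j ≤ a then w j else w (j + d), by simpa using h0, ?_, ?_⟩
  · have h1 : ¬ k - d ≤ a := by omega
    have h2 : k - d + d = k := by omega
    simp only [h1, h2, if_false, hk]
  · intro j hj hjk
    rcases lt_trichotomy j (a + 1) with hlt | rfl | hgt
    · have h1 : j - 1 ≤ a := by omega
      have h2 : j ≤ a := by omega
      simp only [h1, h2, if_true]
      exact hadj j hj (by omega)
    · have h1 : ¬ a + 1 ≤ a := by omega
      simp only [Nat.add_sub_cancel, h1, le_refl, if_true, if_false]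
      exact ⟨hne, hcard⟩
    · have h1 : ¬ j - 1 ≤ a := by omega
      have h2 : ¬ j ≤ a := by omega
      have h3 : j - 1 + d = j + d - 1 := by omega
      simp only [h1, h2, h3, if_false]
      exact hadj (j + d) (by omega) (by omega)

/-- An `s`-walk of minimum length has pairwise distinct indices. -/
theorem IsSWalk.ne_of_minimal {V ι : Type*} [DecidableEq V] {e : ι → Finset V} {s k : ℕ}
    {w : ℕ → ι} {f g : ι} (h : IsSWalk e s k w f g)
    (hmin : ∀ m w', IsSWalk e s m w' f g → k ≤ m) {a b : ℕ} (hab : a < b) (hb : b ≤ k) :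
    w a ≠ w b := by
  intro heq
  rcases hb.eq_or_lt with rfl | hlt
  · have := hmin a w ⟨h.1, heq.trans h.2.1, fun j hj hja => h.2.2 j hj (by omega)⟩
    omega
  · have hstep := h.2.2 (b + 1) (by omega) hlt
    have hb' : a + 1 + (b - a) = b + 1 := by omega
    rw [Nat.add_sub_cancel, ← heq, ← hb'] at hstep
    obtain ⟨w', hw'⟩ := h.exists_shortcut (by omega) hstep.1 hstep.2
    have := hmin _ _ hw'
    omega

/-- Hyperedges that are not consecutive in an `s`-walk of minimum length are not `s`-adjacent. -/
theorem IsSWalk.card_inter_lt_of_minimal {V ι : Type*} [DecidableEq V] {e : ι → Finset V}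
    {s k : ℕ} {w : ℕ → ι} {f g : ι} (h : IsSWalk e s k w f g)
    (hmin : ∀ m w', IsSWalk e s m w' f g → k ≤ m) {a b : ℕ} (hab : a + 1 < b) (hb : b ≤ k) :
    (e (w a) ∩ e (w b)).card < s := by
  by_contra! hcard
  have hb' : a + 1 + (b - a - 1) = b := by omega
  have hne := h.ne_of_minimal hmin (show a < b by omega) hb
  rw [← hb'] at hcard hne
  obtain ⟨w', hw'⟩ := h.exists_shortcut (by omega) hne hcard
  have := hmin _ _ hw'
  omega

/-- An `s`-walk of minimum length is an `s`-path. -/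
theorem IsSWalk.isSPath_of_minimal {V ι : Type*} [DecidableEq V] {e : ι → Finset V} {s k : ℕ}
    {w : ℕ → ι} {f g : ι} (h : IsSWalk e s k w f g)
    (hmin : ∀ m w', IsSWalk e s m w' f g → k ≤ m) : IsSPath e s k w f g := by
  have hsub : ∀ x, 1 ≤ x → x ≤ k → ∀ y, 1 ≤ y → y ≤ k → x ≠ y →
      ¬ e (w (x - 1)) ∩ e (w x) ⊆ e (w (y - 1)) ∩ e (w y) := by
    intro x hx hxk y hy hyk hxy hss
    have hcard := (h.2.2 x hx hxk).2
    rcases lt_or_gt_of_ne hxy with hlt | hlt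
    · have hle : e (w (x - 1)) ∩ e (w x) ⊆ e (w (x - 1)) ∩ e (w y) :=
        Finset.subset_inter Finset.inter_subset_left (hss.trans Finset.inter_subset_right)
      exact (h.card_inter_lt_of_minimal hmin (by omega) hyk).not_ge
        (hcard.trans (Finset.card_le_card hle))
    · have hle : e (w (x - 1)) ∩ e (w x) ⊆ e (w (y - 1)) ∩ e (w x) :=
        Finset.subset_inter (hss.trans Finset.inter_subset_left) Finset.inter_subset_right
      exact (h.card_inter_lt_of_minimal hmin (by omega) hxk).not_ge
        (hcard.trans (Finset.card_le_card hle))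
  refine ⟨⟨⟨h, fun x hx y hy hxy => ?_⟩, fun x hx hxk y hy hyk hxy heq =>
    hsub x hx hxk y hy hyk hxy heq.subset⟩, fun x hx hxk y hy hyk hxy =>
    Finset.sdiff_nonempty.2 (hsub x hx hxk y hy hyk hxy)⟩
  rcases lt_or_gt_of_ne hxy with hlt | hlt
  · exact h.ne_of_minimal hmin hlt hy
  · exact (h.ne_of_minimal hmin hlt hx).symm

/-- Every `s`-walk can be replaced by an `s`-path that is at most as long. -/
theorem IsSWalk.exists_isSPath_le {V ι : Type*} [DecidableEq V] {e : ι → Finset V} {s k : ℕ}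
    {w : ℕ → ι} {f g : ι} (h : IsSWalk e s k w f g) :
    ∃ m ≤ k, ∃ w', IsSPath e s m w' f g := by
  classical
  have hex : ∃ m w', IsSWalk e s m w' f g := ⟨k, w, h⟩
  obtain ⟨w', hw'⟩ := Nat.find_spec hex
  exact ⟨Nat.find hex, Nat.find_min' hex ⟨w, h⟩, w',
    hw'.isSPath_of_minimal fun m v hv => Nat.find_min' hex ⟨v, hv⟩⟩

/-- There is an `s`-walk between `f` and `g` iff there is an `s`-path between them;
moreover the minimum length of an `s`-walk equals the minimum length of an `s`-path,
i.e. the `s`-distance (defined via shortest `s`-walks) coincides with the length of a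
shortest `s`-path (both being `∞` when no connecting walk exists). -/
theorem sWalk_iff_sPath_and_sDist_eq {V ι : Type*} [DecidableEq V] (e : ι → Finset V)
    (s : ℕ) (hs : 0 < s) (f g : ι) :
    ((∃ (k : ℕ) (w : ℕ → ι), IsSWalk e s k w f g) ↔
      (∃ (k : ℕ) (w : ℕ → ι), IsSPath e s k w f g)) ∧
    sDist e s f g = sInf {n : ℕ∞ | ∃ k : ℕ, n = k ∧ ∃ w : ℕ → ι, IsSPath e s k w f g} := by
  refine ⟨⟨fun ⟨k, w, h⟩ => ?_, fun ⟨k, w, h⟩ => ⟨k, w, h.1.1.1⟩⟩, le_antisymm ?_ ?_⟩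
  · obtain ⟨m, -, w', hw'⟩ := h.exists_isSPath_le
    exact ⟨m, w', hw'⟩
  · exact sInf_le_sInf fun n ⟨k, hn, w, h⟩ => ⟨k, hn, w, h.1.1.1⟩
  · refine le_sInf ?_
    rintro n ⟨k, rfl, w, h⟩
    obtain ⟨m, hmk, w', hw'⟩ := h.exists_isSPath_le
    exact sInf_le_of_le (b := (m : ℕ∞)) ⟨m, rfl, w', hw'⟩ (by exact_mod_cast hmk)
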